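/- For every g ≥ 3, the symplectic group Sp(2g,ℤ) is perfect: its commutator subgroup is the whole group, i.e. Sp(2g,ℤ)/Sp(2g,ℤ)′ is trivial. -/

import Mathlib

open Matrix

/-- The subgroup of `GL n R` consisting of matrices `M` with `ᵀM · J · M = J`. -/
def sympGroup (n : Type*) [Fintype n] [DecidableEq n] (R : Type*) [CommRing R]
    (J : Matrix n n R) : Subgroup (GL n R) where
  carrier := {g | (g : Matrix n n R)ᵀ * J * (g : Matrix n n R) = J}
  one_mem' := by simp
  mul_mem' := by
    intro a b ha hb
    simp only [Set.mem_setOf_eq] at ha hb ⊢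
    have hab : ((a * b : GL n R) : Matrix n n R) = (a : Matrix n n R) * (b : Matrix n n R) :=
      rfl
    rw [hab, Matrix.transpose_mul]
    calc (b : Matrix n n R)ᵀ * (a : Matrix n n R)ᵀ * J * ((a : Matrix n n R) * (b : Matrix n n R))
        = (b : Matrix n n R)ᵀ * ((a : Matrix n n R)ᵀ * J * (a : Matrix n n R)) *
            (b : Matrix n n R) := by
          simp only [Matrix.mul_assoc]
      _ = J := by rw [ha, hb]
  inv_mem' := by
    intro a ha
    simp only [Set.mem_setOf_eq] at ha ⊢
    have key : ((a : GL n R) : Matrix n n R) * ((a⁻¹ : GL n R) : Matrix n n R) = 1 := by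
      rw [← Units.val_mul, mul_inv_cancel, Units.val_one]
    have h2 : ((a⁻¹ : GL n R) : Matrix n n R)ᵀ * ((a : GL n R) : Matrix n n R)ᵀ = 1 := by
      rw [← Matrix.transpose_mul, key, Matrix.transpose_one]
    calc ((a⁻¹ : GL n R) : Matrix n n R)ᵀ * J * ((a⁻¹ : GL n R) : Matrix n n R)
        = ((a⁻¹ : GL n R) : Matrix n n R)ᵀ *
            ((a : Matrix n n R)ᵀ * J * (a : Matrix n n R)) *
            ((a⁻¹ : GL n R) : Matrix n n R) := by rw [ha]
      _ = (((a⁻¹ : GL n R) : Matrix n n R)ᵀ * ((a : GL n R) : Matrix n n R)ᵀ) * J *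
            (((a : GL n R) : Matrix n n R) * ((a⁻¹ : GL n R) : Matrix n n R)) := by
          simp only [Matrix.mul_assoc]
      _ = J := by rw [h2, key, Matrix.one_mul, Matrix.mul_one]

/-- `Sp(2g,ℤ)`: the group of `2g×2g` integer matrices `M` with `ᵀM·J·M = J`,
where `J = ((0, I_g), (−I_g, 0))` is the standard symplectic form. -/
def SpZ (g : ℕ) : Subgroup (GL (Fin g ⊕ Fin g) ℤ) :=
  sympGroup (Fin g ⊕ Fin g) ℤ (Matrix.fromBlocks 0 1 (-1) 0)

namespace SpZ

variable {g : ℕ}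

/-- The standard symplectic form on `ℤ²ᵍ`. -/
def form : LinearMap.BilinForm ℤ (Fin g ⊕ Fin g → ℤ) :=
  Matrix.toLinearMap₂' ℤ (Matrix.fromBlocks 0 1 (-1) 0)

lemma form_apply (x y : Fin g ⊕ Fin g → ℤ) :
    form x y = ∑ i, (x (.inl i) * y (.inr i) - x (.inr i) * y (.inl i)) := by
  simp [form, Matrix.toLinearMap₂'_apply', dotProduct, Fintype.sum_sum_type,
    Matrix.fromBlocks_mulVec, Finset.sum_add_distrib, sub_eq_add_neg, Matrix.neg_mulVec]

lemma form_self (x : Fin g ⊕ Fin g → ℤ) : form x x = 0 := by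
  simp [form_apply, mul_comm]

lemma form_neg_swap (x y : Fin g ⊕ Fin g → ℤ) : -form x y = form y x :=
  LinearMap.IsAlt.neg form_self x y

/-- The basis vector `e i` of the standard symplectic basis. -/
def e (i : Fin g) : Fin g ⊕ Fin g → ℤ := Pi.single (.inl i) 1

/-- The basis vector `f i` of the standard symplectic basis. -/
def f (i : Fin g) : Fin g ⊕ Fin g → ℤ := Pi.single (.inr i) 1

@[simp] lemma form_e_left (i : Fin g) (x : Fin g ⊕ Fin g → ℤ) : form (e i) x = x (.inr i) := by
  simp [form_apply, e, Pi.single_apply]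

@[simp] lemma form_f_left (i : Fin g) (x : Fin g ⊕ Fin g → ℤ) : form (f i) x = -x (.inl i) := by
  simp [form_apply, f, Pi.single_apply]

lemma form_e_e (i j : Fin g) : form (e i) (e j) = 0 := by
  rw [form_e_left]
  simp [e]

lemma form_f_f (i j : Fin g) : form (f i) (f j) = 0 := by
  rw [form_f_left]
  simp [f]

lemma form_e_f (i : Fin g) : form (e i) (f i) = 1 := by simp [f]

lemma mem_iff_form (M : GL (Fin g ⊕ Fin g) ℤ) :
    M ∈ SpZ g ↔ ∀ x y : Fin g ⊕ Fin g → ℤ, form (M • x) (M • y) = form x y := by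
  have h : ∀ x y : Fin g ⊕ Fin g → ℤ, form (M • x) (M • y) =
      Matrix.toLinearMap₂' ℤ (M.valᵀ * Matrix.fromBlocks 0 1 (-1) 0 * M.val) x y := by
    intro x y
    simp only [form, Matrix.toLinearMap₂'_apply', Units.smul_def, Matrix.smul_eq_mulVec,
      ← Matrix.mulVec_mulVec]
    rw [Matrix.dotProduct_mulVec x, Matrix.vecMul_transpose]
  simp only [h]
  rw [← LinearMap.ext_iff₂, form, EmbeddingLike.apply_eq_iff_eq]
  rfl

@[simp] lemma form_smul_smul (M : SpZ g) (x y : Fin g ⊕ Fin g → ℤ) :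
    form (M • x) (M • y) = form x y :=
  (mem_iff_form M.1).1 M.2 x y

lemma smul_zsmul_comm (M : SpZ g) (c : ℤ) (x : Fin g ⊕ Fin g → ℤ) :
    M • (c • x) = c • (M • x) :=
  (DistribSMul.toAddMonoidHom (Fin g ⊕ Fin g → ℤ) M).map_zsmul c x

lemma ext_smul {M N : SpZ g} (h : ∀ x : Fin g ⊕ Fin g → ℤ, M • x = N • x) : M = N :=
  Subtype.ext (Units.ext (Matrix.ext_iff_smul.2 h))

lemma eq_one_of_smul_basis {M : SpZ g} (he : ∀ i : Fin g, M • e i = e i)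
    (hf : ∀ i : Fin g, M • f i = f i) :
    M = 1 := by
  have h : ∀ (x : Fin g ⊕ Fin g → ℤ), M⁻¹ • x = x := fun x => by
    ext (i | i)
    · have h := form_smul_smul M (f i) (M⁻¹ • x)
      rw [smul_inv_smul, hf, form_f_left, form_f_left, neg_inj] at h
      exact h.symm
    · have h := form_smul_smul M (e i) (M⁻¹ • x)
      rw [smul_inv_smul, he, form_e_left, form_e_left] at h
      exact h.symm
  exact ext_smul fun x => by simpa using (congrArg (M • ·) (h x)).symm

/-- The symplectic transvection `x ↦ x + form u x • u`. -/
def transvection (u : Fin g ⊕ Fin g → ℤ) : SpZ g :=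
  let A := Matrix.vecMulVec u (u ᵥ* Matrix.fromBlocks 0 1 (-1) 0)
  have hA (x : Fin g ⊕ Fin g → ℤ) : A *ᵥ x = form u x • u := by
    simp [A, Matrix.vecMulVec_mulVec, form, Matrix.toLinearMap₂'_apply', Matrix.dotProduct_mulVec]
  have hAA : A * A = 0 := Matrix.ext_iff_mulVec.2 fun x => by
    simp [← Matrix.mulVec_mulVec, hA, form_self, -zsmul_eq_mul]
  ⟨⟨1 + A, 1 - A, by noncomm_ring; simp [hAA], by noncomm_ring; simp [hAA]⟩, by
    refine (mem_iff_form _).2 fun x y => ?_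
    simp only [Units.smul_def, Matrix.smul_eq_mulVec, Matrix.add_mulVec, Matrix.one_mulVec, hA,
      map_add, LinearMap.add_apply, map_smul, LinearMap.smul_apply, form_self,
      ← form_neg_swap u x, smul_eq_mul]
    ring⟩

lemma transvection_smul (u x : Fin g ⊕ Fin g → ℤ) :
    transvection u • x = x + form u x • u := by
  simp [transvection, Subgroup.smul_def, Units.smul_def, Matrix.add_mulVec,
    Matrix.vecMulVec_mulVec, form, Matrix.toLinearMap₂'_apply', Matrix.dotProduct_mulVec]

lemma transvection_zpow_smul (u : Fin g ⊕ Fin g → ℤ) (m : ℤ) (x : Fin g ⊕ Fin g → ℤ) :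
    transvection u ^ m • x = x + (m * form u x) • u := by
  induction m generalizing x with
  | zero => simp
  | succ m ih =>
    rw [_root_.zpow_add_one, mul_smul, ih, transvection_smul]
    simp only [map_add, map_smul, form_self]
    module
  | pred m ih =>
    rw [← smul_left_cancel_iff (transvection u), ← mul_smul, ← _root_.zpow_one_add, add_sub_cancel, ih,
      transvection_smul]
    simp only [map_add, map_smul, form_self]
    module

lemma mul_transvection (M : SpZ g) (u : Fin g ⊕ Fin g → ℤ) :
    M * transvection u = transvection (M • u) * M :=
  ext_smul fun x => by
    simp [mul_smul, transvection_smul, smul_zsmul_comm, -zsmul_eq_mul]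

/-- The lantern relation between transvections along three pairwise orthogonal vectors. -/
lemma lantern {x y z : Fin g ⊕ Fin g → ℤ} (hxy : form x y = 0) (hyz : form y z = 0)
    (hxz : form x z = 0) :
    transvection (x + y + z) * transvection x * transvection y * transvection z =
      transvection (x + y) * transvection (y + z) * transvection (x + z) := by
  have hyx : form y x = 0 := by rw [← form_neg_swap, hxy, neg_zero]
  have hzy : form z y = 0 := by rw [← form_neg_swap, hyz, neg_zero]
  have hzx : form z x = 0 := by rw [← form_neg_swap, hxz, neg_zero]
  refine ext_smul fun p => ?_
  simp only [mul_smul, transvection_smul, map_add, map_smul, LinearMap.add_apply, form_self,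
    hxy, hyz, hxz, hyx, hzy, hzx]
  module

/-- The group generated by the transvections along vectors that are unimodular in `W`. -/
def transvectionSubgroup (W : Submodule ℤ (Fin g ⊕ Fin g → ℤ)) : Subgroup (SpZ g) :=
  Subgroup.closure (transvection '' {u | u ∈ W ∧ ∃ w ∈ W, form u w = 1})

section

variable {W W' : Submodule ℤ (Fin g ⊕ Fin g → ℤ)} {u v w x y : Fin g ⊕ Fin g → ℤ} {h : SpZ g}

lemma transvection_mem (hu : u ∈ W) (hw : w ∈ W) (huw : form u w = 1) :
    transvection u ∈ transvectionSubgroup W :=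
  Subgroup.subset_closure ⟨u, ⟨hu, w, hw, huw⟩, rfl⟩

lemma transvectionSubgroup_mono (hW : W ≤ W') :
    transvectionSubgroup W ≤ transvectionSubgroup W' :=
  Subgroup.closure_mono <| Set.image_mono fun _ ⟨hu, w, hw, huw⟩ => ⟨hW hu, w, hW hw, huw⟩

lemma smul_sub_mem (hh : h ∈ transvectionSubgroup W) (x : Fin g ⊕ Fin g → ℤ) : h • x - x ∈ W := by
  induction hh using Subgroup.closure_induction generalizing x with
  | mem _ hu =>
    obtain ⟨u, ⟨hu, -⟩, rfl⟩ := hu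
    simpa [transvection_smul] using W.smul_mem _ hu
  | one => simp
  | mul a b _ _ ha hb =>
    rw [mul_smul, ← sub_add_sub_cancel _ (b • x)]
    exact add_mem (ha _) (hb _)
  | inv a _ ha => simpa using neg_mem (ha (a⁻¹ • x))

lemma smul_mem (hh : h ∈ transvectionSubgroup W) (hx : x ∈ W) : h • x ∈ W := by
  simpa using add_mem (smul_sub_mem hh x) hx

lemma smul_eq_self (hh : h ∈ transvectionSubgroup W) (hx : ∀ w ∈ W, form w x = 0) :
    h • x = x := by
  induction hh using Subgroup.closure_induction with
  | mem _ hu =>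
    obtain ⟨u, ⟨hu, -⟩, rfl⟩ := hu
    simp [transvection_smul, hx u hu]
  | one => simp
  | mul a b _ _ ha hb => rw [mul_smul, hb, ha]
  | inv a _ ha => rw [inv_smul_eq_iff, ha]

lemma exists_smul_eq_of_form_eq_one (hv : v ∈ W) (hw : w ∈ W) (hwv : form w v = 1) :
    ∃ h ∈ transvectionSubgroup W, h • v = w := by
  refine ⟨transvection (w - v), transvection_mem (sub_mem hw hv) hv ?_, ?_⟩
  · simp [hwv, form_self]
  · simp [transvection_smul, hwv, form_self]

/-- Vectors that are unimodular in `W` can be moved to `x` by transvections, where `x`, `y` is a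
hyperbolic pair in `W`. -/
lemma exists_smul_eq (hx : x ∈ W) (hy : y ∈ W) (hxy : form x y = 1) (hv : v ∈ W) (hw : w ∈ W)
    (hvw : form v w = 1) : ∃ h ∈ transvectionSubgroup W, h • v = x := by
  have hyx : form y x = -1 := by rw [← form_neg_swap, hxy]
  have hTx : transvection x ∈ transvectionSubgroup W := transvection_mem hx hy hxy
  have hTy : transvection y ∈ transvectionSubgroup W :=
    transvection_mem hy (neg_mem hx) (by simp [hyx])
  induction hn : (form x v).natAbs using Nat.strong_induction_on generalizing v w with
  | _ n ih =>
  subst hn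
  by_cases hxv : form x v = 0
  · set z := -w + (-form y w - 1) • x with hz_def
    have hz : z ∈ W := add_mem (neg_mem hw) (W.smul_mem _ hx)
    have hzv : form z v = 1 := by
      simp [hz_def, hxv, ← form_neg_swap v w, hvw, -zsmul_eq_mul]
    have hyz : form y z = 1 := by simp [hz_def, hyx, -zsmul_eq_mul]
    obtain ⟨a, ha, hav⟩ := exists_smul_eq_of_form_eq_one hv hz hzv
    obtain ⟨b, hb, hbz⟩ := exists_smul_eq_of_form_eq_one hz hy hyz
    obtain ⟨c, hc, hcy⟩ := exists_smul_eq_of_form_eq_one hy hx hxy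
    exact ⟨c * b * a, mul_mem (mul_mem hc hb) ha, by rw [mul_smul, mul_smul, hav, hbz, hcy]⟩
  · set k := transvection y * transvection x * transvection y *
      transvection x ^ (form y v / form x v) with hk_def
    have hk : k ∈ transvectionSubgroup W :=
      mul_mem (mul_mem (mul_mem hTy hTx) hTy) (zpow_mem hTx _)
    have hkv : form x (k • v) = form y v % form x v := by
      rw [Int.emod_def]
      simp only [hk_def, mul_smul, transvection_smul, transvection_zpow_smul, map_add, map_smul,
        form_self, hxy, hyx, smul_eq_mul]
      ring
    obtain ⟨h, hh, hhv⟩ := ih _ (by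
      rw [hkv]
      have h1 := Int.emod_nonneg (form y v) hxv
      have h2 := Int.emod_lt_abs (form y v) hxv
      rw [← Int.ofNat_lt, Int.natCast_natAbs, Int.natCast_natAbs, abs_of_nonneg h1]
      exact h2) (smul_mem hk hv) (smul_mem hk hw) (by simpa using hvw) rfl
    exact ⟨h * k, mul_mem hh hk, by rw [mul_smul, hhv]⟩

/-- Hyperbolic pairs in `W` are permuted transitively by transvections. -/
lemma exists_smul_eq_and_smul_eq (hx : x ∈ W) (hy : y ∈ W) (hxy : form x y = 1) (hv : v ∈ W)
    (hw : w ∈ W) (hvw : form v w = 1) :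
    ∃ h ∈ transvectionSubgroup W, h • v = x ∧ h • w = y := by
  obtain ⟨h, hh, rfl⟩ := exists_smul_eq hx hy hxy hv hw hvw
  set x := h • v
  have hyx : form y x = -1 := by rw [← form_neg_swap, hxy]
  have hTx : transvection x ∈ transvectionSubgroup W := transvection_mem hx hy hxy
  set k := transvection x ^ (form y (h • w) - 1)
  have hxw : form x (h • w) = 1 := by simpa [x] using hvw
  have hkw : k • h • w = h • w + (form y (h • w) - 1) • x := by
    simp [k, transvection_zpow_smul, hxw]
  have hkx : k • x = x := by simp [k, transvection_zpow_smul, form_self]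
  have hk : k ∈ transvectionSubgroup W := zpow_mem hTx _
  have hkwW : k • h • w ∈ W := smul_mem hk (smul_mem hh hw)
  have hykw : form y (k • h • w) = 1 := by simp [hkw, hyx, -zsmul_eq_mul]
  have hxkw : form x (k • h • w) = 1 := by simp [hkw, form_self, hxw, -zsmul_eq_mul]
  refine ⟨transvection (y - k • h • w) * k * h, mul_mem (mul_mem ?_ hk) hh, ?_, ?_⟩
  · exact transvection_mem (sub_mem hy hkwW) hkwW (by simp [hykw, form_self])
  · rw [mul_smul, mul_smul, hkx, transvection_smul]
    simp [hyx, ← form_neg_swap x (k • h • w), hxkw]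
  · rw [mul_smul, mul_smul, transvection_smul]
    simp [hykw, form_self]

end

/-- The orthogonal complement of the first `k` standard hyperbolic planes. -/
def tail (g k : ℕ) : Submodule ℤ (Fin g ⊕ Fin g → ℤ) where
  carrier := {x | ∀ i : Fin g, i < k → form (e i) x = 0 ∧ form (f i) x = 0}
  zero_mem' := by simp
  add_mem' := by
    intro x y hx hy i hi
    rw [map_add, map_add, (hx i hi).1, (hx i hi).2, (hy i hi).1, (hy i hi).2]
    simp
  smul_mem' := by
    intro c x hx i hi
    rw [map_smul, map_smul, (hx i hi).1, (hx i hi).2]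
    simp

lemma e_mem_tail {k : ℕ} {i : Fin g} (hi : k ≤ i) : e i ∈ tail g k := by
  intro j hj
  have : i ≠ j := by rintro rfl; omega
  exact ⟨form_e_e j i, by rw [form_f_left]; simp [e, this.symm]⟩

lemma f_mem_tail {k : ℕ} {i : Fin g} (hi : k ≤ i) : f i ∈ tail g k := by
  intro j hj
  have : i ≠ j := by rintro rfl; omega
  exact ⟨by rw [form_e_left]; simp [f, this.symm], form_f_f j i⟩

lemma exists_mul_fixes (M : SpZ g) (k : ℕ) (hk : k ≤ g) :
    ∃ h ∈ transvectionSubgroup (⊤ : Submodule ℤ (Fin g ⊕ Fin g → ℤ)),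
      ∀ i : Fin g, i < k → (h * M) • e i = e i ∧ (h * M) • f i = f i := by
  induction k with
  | zero => exact ⟨1, one_mem _, by simp⟩
  | succ k ih =>
    obtain ⟨h, hh, hfix⟩ := ih (by omega)
    set N := h * M
    let j : Fin g := ⟨k, hk⟩
    have hN {x : Fin g ⊕ Fin g → ℤ} (hx : x ∈ tail g k) : N • x ∈ tail g k := fun i hi => by
      have h1 := form_smul_smul N (e i) x
      have h2 := form_smul_smul N (f i) x
      rw [(hfix i hi).1] at h1
      rw [(hfix i hi).2] at h2
      rw [h1, h2]
      exact hx i hi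
    have hej : e j ∈ tail g k := e_mem_tail le_rfl
    have hfj : f j ∈ tail g k := f_mem_tail le_rfl
    obtain ⟨h', hh', he, hf⟩ := exists_smul_eq_and_smul_eq hej hfj (form_e_f j) (hN hej) (hN hfj)
      (by rw [form_smul_smul, form_e_f])
    refine ⟨h' * h, mul_mem (transvectionSubgroup_mono le_top hh') hh, fun i hi => ?_⟩
    rw [mul_assoc, mul_smul h', mul_smul h']
    obtain hi | hi : i < k ∨ (i : ℕ) = k := by omega
    · rw [(hfix i hi).1, (hfix i hi).2]
      constructor <;> refine smul_eq_self hh' fun w hw => ?_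
      · rw [← form_neg_swap, (hw i hi).1, neg_zero]
      · rw [← form_neg_swap, (hw i hi).2, neg_zero]
    · obtain rfl : i = j := Fin.ext hi
      exact ⟨he, hf⟩

/-- `Sp(2g,ℤ)` is generated by transvections along unimodular vectors. -/
theorem transvectionSubgroup_top :
    transvectionSubgroup (⊤ : Submodule ℤ (Fin g ⊕ Fin g → ℤ)) = ⊤ := by
  refine (Subgroup.eq_top_iff' _).2 fun M => ?_
  obtain ⟨h, hh, hfix⟩ := exists_mul_fixes M g le_rfl
  have hM : h * M = 1 :=
    eq_one_of_smul_basis (fun i => (hfix i i.2).1) (fun i => (hfix i i.2).2)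
  rw [eq_inv_of_mul_eq_one_right hM]
  exact inv_mem hh

/-- Transvections along unimodular vectors agree in the abelianization. -/
lemma abelianization_transvection_eq {u v u' v' : Fin g ⊕ Fin g → ℤ} (h : form u v = 1)
    (h' : form u' v' = 1) :
    Abelianization.of (transvection u) = Abelianization.of (transvection u') := by
  obtain ⟨M, -, rfl⟩ := exists_smul_eq (W := ⊤) trivial trivial h' (v := u) (w := v)
    trivial trivial h
  have := congrArg Abelianization.of (mul_transvection M u)
  rwa [map_mul, map_mul, mul_comm, mul_left_inj] at this

lemma abelianization_transvection_eq_one (hg : 3 ≤ g) {u v : Fin g ⊕ Fin g → ℤ}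
    (h : form u v = 1) : Abelianization.of (transvection u) = 1 := by
  let i : Fin g := ⟨0, by omega⟩
  let j : Fin g := ⟨1, by omega⟩
  let k : Fin g := ⟨2, by omega⟩
  have hij : i ≠ j := by simp [i, j]
  have hik : i ≠ k := by simp [i, k]
  have hjk : j ≠ k := by simp [j, k]
  have key {w z : Fin g ⊕ Fin g → ℤ} (hw : form w z = 1) :
      Abelianization.of (transvection w) = Abelianization.of (transvection u) :=
    abelianization_transvection_eq hw h
  have hL := congrArg Abelianization.of
    (lantern (x := e i) (y := e j) (z := e k) (form_e_e i j) (form_e_e j k) (form_e_e i k))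
  simp only [map_mul] at hL
  rw [key (w := e i + e j + e k) (z := f i) (by simp [f, hij.symm, hik.symm]),
    key (form_e_f i), key (form_e_f j), key (form_e_f k),
    key (w := e i + e j) (z := f i) (by simp [f, hij.symm]),
    key (w := e j + e k) (z := f j) (by simp [f, hjk.symm]),
    key (w := e i + e k) (z := f i) (by simp [f, hik.symm])] at hL
  simpa using hL

end SpZ

/-- For every `g ≥ 3`, the symplectic group `Sp(2g,ℤ)` is perfect: its commutator
subgroup is the whole group. -/
theorem Sp2gZ_perfect (g : ℕ) (hg : 3 ≤ g) : commutator (SpZ g) = ⊤ := by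
  rw [← Abelianization.ker_of, ← top_le_iff, ← SpZ.transvectionSubgroup_top,
    SpZ.transvectionSubgroup, Subgroup.closure_le]
  rintro _ ⟨u, ⟨-, v, -, huv⟩, rfl⟩
  exact SpZ.abelianization_transvection_eq_one hg huv
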